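/- arXiv:2304.08455 — 4 statements merged into one kernel-verified Lean document; each statement's English description precedes it below -/
import Mathlib

section
/- Let R > 0, M ∈ ℝ, and C ≥ 0. Then there exist constants δ₀ > 0 and C′ > 0, depending only on R, M, and C, such that the following holds. For every δ with 0 < δ ≤ δ₀ and every λ ≥ 0 with λ² ≤ δ^{1/2}, if e : [0,1] → ℝ is continuous with 0 ≤ e(v) ≤ Cλ² for all v, and φ : [0,1] → ℝ is twice continuously differentiable with φ″ + e·φ = 0 on [0,1], φ(1) = R, and φ′(1) = δ(1 − 2M/R), then |φ(v) − R| + |φ′(v)| ≤ C′(δ + λ²) for all v ∈ [0,1]. -/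
open Set

/-- A priori estimate for the conformal factor: if `φ'' + e φ = 0` on `[0,1]` with
`0 ≤ e ≤ C λ²`, `φ(1) = R`, `φ'(1) = δ (1 - 2M/R)`, `0 < δ ≤ δ₀` and `λ² ≤ δ^{1/2}`, then
`|φ - R| + |φ'| ≤ C' (δ + λ²)` on `[0,1]`. -/
theorem stmt8 (R M C : ℝ) (hR : 0 < R) (hC : 0 ≤ C) :
    ∃ δ₀ > (0 : ℝ), ∃ C' > (0 : ℝ),
      ∀ δ : ℝ, 0 < δ → δ ≤ δ₀ →
      ∀ lam : ℝ, 0 ≤ lam → lam ^ 2 ≤ Real.sqrt δ →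
      ∀ e φ φ' φ'' : ℝ → ℝ,
        ContinuousOn e (Icc 0 1) →
        (∀ v ∈ Icc (0 : ℝ) 1, 0 ≤ e v ∧ e v ≤ C * lam ^ 2) →
        (∀ v ∈ Icc (0 : ℝ) 1, HasDerivWithinAt φ (φ' v) (Icc 0 1) v) →
        (∀ v ∈ Icc (0 : ℝ) 1, HasDerivWithinAt φ' (φ'' v) (Icc 0 1) v) →
        ContinuousOn φ'' (Icc 0 1) →
        (∀ v ∈ Icc (0 : ℝ) 1, φ'' v + e v * φ v = 0) →
        φ 1 = R →
        φ' 1 = δ * (1 - 2 * M / R) →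
        ∀ v ∈ Icc (0 : ℝ) 1, |φ v - R| + |φ' v| ≤ C' * (δ + lam ^ 2) := by
  have hC1 : 0 < 2 * (C + 1) := by linarith
  have hA := abs_nonneg (1 - 2 * M / R)
  have hCR := mul_nonneg hC hR.le
  refine ⟨(1 / (2 * (C + 1))) ^ 2, by positivity, 4 * (|1 - 2 * M / R| + C * R) + 1,
    by positivity, ?_⟩
  intro δ hδ hδ₀ lam hlam hlam2 e φ φ' φ'' _he heb hφ hφ' _hc hode hφ1 hφ'1 v hv
  have hs : Real.sqrt δ ≤ 1 / (2 * (C + 1)) := by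
    rw [Real.sqrt_le_left (by positivity)]
    exact hδ₀
  have hl0 : 0 ≤ lam ^ 2 := sq_nonneg lam
  have hl1 : lam ^ 2 * (2 * (C + 1)) ≤ 1 := by
    rw [← le_div_iff₀ hC1]
    exact hlam2.trans hs
  have hhalf : C * lam ^ 2 ≤ 1 / 2 := by nlinarith
  have hcl : 0 ≤ C * lam ^ 2 := mul_nonneg hC hl0
  have h1 : (1 : ℝ) ∈ Icc (0 : ℝ) 1 := ⟨zero_le_one, le_rfl⟩
  have hcφ : ContinuousOn φ (Icc 0 1) := fun x hx => (hφ x hx).continuousWithinAt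
  have hcont : ContinuousOn (fun x => |φ x - R|) (Icc 0 1) :=
    (hcφ.sub continuousOn_const).abs
  obtain ⟨w, hw, hmax⟩ := isCompact_Icc.exists_isMaxOn ⟨1, h1⟩ hcont
  have hmax' : ∀ x ∈ Icc (0 : ℝ) 1, |φ x - R| ≤ |φ w - R| := fun x hx => hmax hx
  obtain ⟨K, hK⟩ : ∃ K, K = |φ w - R| := ⟨_, rfl⟩
  rw [← hK] at hmax'
  have hK0 : 0 ≤ K := hK ▸ abs_nonneg _
  have hd : ∀ x ∈ Icc (0 : ℝ) 1, |x - 1| ≤ 1 := by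
    intro x hx
    rw [abs_le]
    constructor <;> linarith [hx.1, hx.2]
  have hb2 : ∀ x ∈ Icc (0 : ℝ) 1, ‖φ'' x‖ ≤ C * lam ^ 2 * (R + K) := by
    intro x hx
    have h : φ'' x = -(e x * φ x) := by linarith [hode x hx]
    rw [h, norm_neg, norm_mul, Real.norm_eq_abs, Real.norm_eq_abs, abs_of_nonneg (heb x hx).1]
    have : |φ x| ≤ R + K := by
      have := abs_le.1 (hmax' x hx)
      rw [abs_le]
      constructor <;> linarith [this.1, this.2]
    exact mul_le_mul (heb x hx).2 this (abs_nonneg _) hcl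
  obtain ⟨B, hB⟩ : ∃ B, B = δ * |1 - 2 * M / R| + C * lam ^ 2 * (R + K) := ⟨_, rfl⟩
  have hp : 0 ≤ C * lam ^ 2 * (R + K) := by positivity
  have hB0 : 0 ≤ B := by rw [hB]; positivity
  have hb1 : ∀ x ∈ Icc (0 : ℝ) 1, ‖φ' x‖ ≤ B := by
    intro x hx
    have h := (convex_Icc (0 : ℝ) 1).norm_image_sub_le_of_norm_hasDerivWithin_le hφ' hb2 h1 hx
    rw [Real.norm_eq_abs, Real.norm_eq_abs] at h
    have h2 := mul_le_mul_of_nonneg_left (hd x hx) hp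
    have h3 : |φ' 1| = δ * |1 - 2 * M / R| := by rw [hφ'1, abs_mul, abs_of_pos hδ]
    have h4 := abs_sub_abs_le_abs_sub (φ' x) (φ' 1)
    rw [Real.norm_eq_abs]
    linarith
  have hb0 : ∀ x ∈ Icc (0 : ℝ) 1, |φ x - R| ≤ B := by
    intro x hx
    have h := (convex_Icc (0 : ℝ) 1).norm_image_sub_le_of_norm_hasDerivWithin_le hφ hb1 h1 hx
    rw [Real.norm_eq_abs, Real.norm_eq_abs, hφ1] at h
    have h2 := mul_le_mul_of_nonneg_left (hd x hx) hB0
    linarith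
  have hKB : K ≤ B := hK ▸ hb0 w hw
  have hBK : C * lam ^ 2 * K ≤ 1 / 2 * B := mul_le_mul hhalf hKB hK0 (by norm_num)
  have e1 := hb0 v hv
  have e2 := hb1 v hv
  rw [Real.norm_eq_abs] at e2
  have p1 := mul_nonneg hA hl0
  have p2 := mul_nonneg hCR hδ.le
  nlinarith
end

section
/- Let e : [0,1] → ℝ be continuous with e ≥ 0, let 0 ≤ λ₁ < λ₂ and B ≥ 0, and for i = 1, 2 let f_i : [0,1] → ℝ be continuously differentiable and satisfy the Riccati equation f_i′(v) = −2λ_i²e(v) − ½ f_i(v)² on [0,1], with f₁(1) = f₂(1) and |f₁(v)| + |f₂(v)| ≤ B for all v ∈ [0,1]. Then f₂(v) ≥ f₁(v) for all v ∈ [0,1], and f₂(0) − f₁(0) ≥ 2(λ₂² − λ₁²) e^{−B} ∫₀¹ e(v) dv; in particular, if ∫₀¹ e > 0 then f₂(0) > f₁(0). -/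
open Set

/-- Comparison principle in the pulse amplitude: for solutions `f₁, f₂` of
`fᵢ' = -2λᵢ² e - ½ fᵢ²` on `[0,1]` with `e ≥ 0`, `0 ≤ λ₁ < λ₂`, equal terminal values
and `|f₁| + |f₂| ≤ B`, one has `f₂ ≥ f₁` and
`f₂(0) - f₁(0) ≥ 2(λ₂² - λ₁²) e^{-B} ∫₀¹ e`; in particular `f₂(0) > f₁(0)` if `∫₀¹ e > 0`. -/
theorem stmt11 (e : ℝ → ℝ) (he : ContinuousOn e (Icc 0 1))
    (he0 : ∀ v ∈ Icc (0 : ℝ) 1, 0 ≤ e v)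
    (lam₁ lam₂ B : ℝ) (hlam₁ : 0 ≤ lam₁) (hlam : lam₁ < lam₂) (hB : 0 ≤ B)
    (f₁ f₂ : ℝ → ℝ)
    (hf₁ : ∀ v ∈ Icc (0 : ℝ) 1,
      HasDerivWithinAt f₁ (-2 * lam₁ ^ 2 * e v - (1 / 2) * f₁ v ^ 2) (Icc 0 1) v)
    (hf₂ : ∀ v ∈ Icc (0 : ℝ) 1,
      HasDerivWithinAt f₂ (-2 * lam₂ ^ 2 * e v - (1 / 2) * f₂ v ^ 2) (Icc 0 1) v)
    (hend : f₁ 1 = f₂ 1)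
    (hbd : ∀ v ∈ Icc (0 : ℝ) 1, |f₁ v| + |f₂ v| ≤ B) :
    (∀ v ∈ Icc (0 : ℝ) 1, f₁ v ≤ f₂ v) ∧
      2 * (lam₂ ^ 2 - lam₁ ^ 2) * Real.exp (-B) * (∫ v in (0 : ℝ)..1, e v) ≤ f₂ 0 - f₁ 0 ∧
      ((0 : ℝ) < (∫ v in (0 : ℝ)..1, e v) → f₁ 0 < f₂ 0) := by
  have hext : ∀ h : ℝ → ℝ, ContinuousOn h (Icc 0 1) →
      ∃ k : ℝ → ℝ, Continuous k ∧ ∀ v ∈ Icc (0 : ℝ) 1, k v = h v := by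
    intro h hh
    refine ⟨fun v => h (max 0 (min v 1)), ?_, ?_⟩
    · rw [← continuousOn_univ]
      refine hh.comp (by fun_prop) ?_
      intro v _
      exact ⟨le_max_left _ _, max_le zero_le_one (min_le_right _ _)⟩
    · intro v hv
      simp only [min_eq_left hv.2, max_eq_right hv.1]
  have hc₁ : ContinuousOn f₁ (Icc 0 1) := fun v hv => (hf₁ v hv).continuousWithinAt
  have hc₂ : ContinuousOn f₂ (Icc 0 1) := fun v hv => (hf₂ v hv).continuousWithinAt
  obtain ⟨k, hk, hke⟩ := hext e he
  obtain ⟨g, hg, hge⟩ := hext (fun v => (f₁ v + f₂ v) / 2) ((hc₁.add hc₂).div_const 2)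
  have hc : 0 < 2 * (lam₂ ^ 2 - lam₁ ^ 2) := by nlinarith
  set c := 2 * (lam₂ ^ 2 - lam₁ ^ 2) with hcdef
  have hG : ∀ v, HasDerivAt (fun v => ∫ t in (0 : ℝ)..v, g t) (g v) v := fun v =>
    hg.integral_hasStrictDerivAt 0 v |>.hasDerivAt
  have hE : ∀ v, HasDerivAt (fun v => ∫ t in (0 : ℝ)..v, k t) (k v) v := fun v =>
    hk.integral_hasStrictDerivAt 0 v |>.hasDerivAt
  have hG0 : (∫ t in (0 : ℝ)..0, g t) = 0 := intervalIntegral.integral_same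
  have hE0 : (∫ t in (0 : ℝ)..0, k t) = 0 := intervalIntegral.integral_same
  have hE1 : (∫ t in (0 : ℝ)..1, k t) = ∫ t in (0 : ℝ)..1, e t := by
    apply intervalIntegral.integral_congr
    intro v hv
    rw [uIcc_of_le zero_le_one] at hv
    exact hke v hv
  have hGB : ∀ v ∈ Icc (0 : ℝ) 1, -B ≤ ∫ t in (0 : ℝ)..v, g t := by
    intro v hv
    have h1 : ‖∫ t in (0 : ℝ)..v, g t‖ ≤ B * |v - 0| := by
      apply intervalIntegral.norm_integral_le_of_norm_le_const
      intro t ht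
      rw [uIoc_of_le hv.1] at ht
      have ht' : t ∈ Icc (0 : ℝ) 1 := ⟨ht.1.le, ht.2.trans hv.2⟩
      rw [hge t ht', Real.norm_eq_abs, abs_div, abs_two]
      have := hbd t ht'
      have := abs_add_le (f₁ t) (f₂ t)
      linarith
    rw [sub_zero, abs_of_nonneg hv.1, Real.norm_eq_abs] at h1
    have := neg_abs_le (∫ t in (0 : ℝ)..v, g t)
    nlinarith [hv.2]
  generalize hGd : (fun v => ∫ t in (0 : ℝ)..v, g t) = G at hG
  generalize hEd : (fun v => ∫ t in (0 : ℝ)..v, k t) = E at hE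
  have hGv : ∀ v, (∫ t in (0 : ℝ)..v, g t) = G v := fun v => congrFun hGd v
  have hEv : ∀ v, (∫ t in (0 : ℝ)..v, k t) = E v := fun v => congrFun hEd v
  simp only [hGv] at hG0 hGB
  simp only [hEv] at hE0 hE1
  have key : ∀ m : ℝ, m ≤ Real.exp (-B) →
      AntitoneOn (fun v => (f₂ v - f₁ v) * Real.exp (G v) + c * m * E v) (Icc 0 1) := by
    intro m hm
    have hd : ∀ v ∈ Icc (0 : ℝ) 1, HasDerivWithinAt
        (fun v => (f₂ v - f₁ v) * Real.exp (G v) + c * m * E v)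
        (c * e v * (m - Real.exp (G v))) (Icc 0 1) v := by
      intro v hv
      have := (((hf₂ v hv).sub (hf₁ v hv)).mul (hG v).exp.hasDerivWithinAt).add
        ((hE v).hasDerivWithinAt.const_mul (c * m))
      refine this.congr_deriv ?_
      simp only [Pi.sub_apply]
      rw [hke v hv, hge v hv, hcdef]
      ring
    refine antitoneOn_of_hasDerivWithinAt_nonpos (convex_Icc 0 1)
      (fun v hv => (hd v hv).continuousWithinAt)
      (fun v hv => (hd v (interior_subset hv)).mono interior_subset) ?_
    intro v hv
    have hv' := interior_subset hv
    have h2 : Real.exp (-B) ≤ Real.exp (G v) := Real.exp_le_exp.2 (hGB v hv')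
    exact mul_nonpos_of_nonneg_of_nonpos (mul_nonneg hc.le (he0 v hv')) (by linarith)
  have main : c * Real.exp (-B) * (∫ v in (0 : ℝ)..1, e v) ≤ f₂ 0 - f₁ 0 := by
    have := key _ le_rfl (left_mem_Icc.2 zero_le_one) (right_mem_Icc.2 zero_le_one) zero_le_one
    simpa [hend, hG0, hE0, hE1] using this
  refine ⟨?_, main, ?_⟩
  · intro v hv
    have := key 0 (Real.exp_pos _).le hv (right_mem_Icc.2 zero_le_one) hv.2
    simp only [hend, sub_self, zero_mul, mul_zero, add_zero] at this
    have := nonneg_of_mul_nonneg_left this (Real.exp_pos _)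
    linarith
  · intro hpos
    have := mul_pos (mul_pos hc (Real.exp_pos (-B))) hpos
    linarith
end

section
/- Let e₁, e₂ : [0,1] → ℝ be continuous with ∫₀¹ e₁(v) dv = ∫₀¹ e₂(v) dv, let δ > 0 and A ≥ 0, and for i = 1, 2 let f_i : [0,1] → ℝ be continuously differentiable and satisfy f_i′(v) = −2e_i(v) − ½ f_i(v)² on [0,1], with f₁(1) = f₂(1) and |f_i(v)| ≤ Aδ for all v ∈ [0,1] and i = 1, 2. Then |f₁(0) − f₂(0)| ≤ 2A²δ². -/
open Set

theorem stmt13_aux (e f : ℝ → ℝ) (C : ℝ) (he : ContinuousOn e (Icc 0 1))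
    (hf : ∀ v ∈ Icc (0 : ℝ) 1,
      HasDerivWithinAt f (-2 * e v - (1 / 2) * f v ^ 2) (Icc 0 1) v)
    (hb : ∀ v ∈ Icc (0 : ℝ) 1, |f v| ≤ C) :
    |f 1 - f 0 + 2 * ∫ v in (0 : ℝ)..1, e v| ≤ (1 / 2) * C ^ 2 := by
  have hc : ContinuousOn f (Icc 0 1) := fun v hv => (hf v hv).continuousWithinAt
  have h1 : IntervalIntegrable (fun v => -2 * e v) MeasureTheory.volume 0 1 :=
    ContinuousOn.intervalIntegrable_of_Icc zero_le_one (by fun_prop)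
  have h2 : IntervalIntegrable (fun v => (1 / 2) * f v ^ 2) MeasureTheory.volume 0 1 :=
    ContinuousOn.intervalIntegrable_of_Icc zero_le_one (by fun_prop)
  have h := intervalIntegral.integral_eq_sub_of_hasDerivAt_of_le zero_le_one hc
    (fun x hx => (hf x (Ioo_subset_Icc_self hx)).hasDerivAt (Icc_mem_nhds hx.1 hx.2))
    (h1.sub h2)
  rw [intervalIntegral.integral_sub h1 h2, intervalIntegral.integral_const_mul] at h
  have h3 : ‖∫ v in (0 : ℝ)..1, (1 / 2) * f v ^ 2‖ ≤ (1 / 2) * C ^ 2 * |(1 : ℝ) - 0| := by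
    apply intervalIntegral.norm_integral_le_of_norm_le_const
    intro x hx
    rw [uIoc_of_le zero_le_one] at hx
    have hx' := hb x (Ioc_subset_Icc_self hx)
    have h4 : f x ^ 2 ≤ C ^ 2 := sq_le_sq' (abs_le.1 hx').1 (abs_le.1 hx').2
    rw [Real.norm_eq_abs, abs_of_nonneg (by positivity)]
    linarith
  rw [Real.norm_eq_abs, sub_zero, abs_one, mul_one] at h3
  rw [abs_le] at h3 ⊢
  constructor <;> linarith [h3.1, h3.2]

/-- If `f₁, f₂` solve Riccati equations `fᵢ' = -2eᵢ - ½ fᵢ²` on `[0,1]` with pulse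
energies of equal integral, equal terminal values, and `|fᵢ| ≤ A δ`, then
`|f₁(0) - f₂(0)| ≤ 2 A² δ²`. -/
theorem stmt13 (e₁ e₂ : ℝ → ℝ)
    (he₁ : ContinuousOn e₁ (Icc 0 1)) (he₂ : ContinuousOn e₂ (Icc 0 1))
    (hint : (∫ v in (0 : ℝ)..1, e₁ v) = ∫ v in (0 : ℝ)..1, e₂ v)
    (δ A : ℝ) (hδ : 0 < δ) (hA : 0 ≤ A)
    (f₁ f₂ : ℝ → ℝ)
    (hf₁ : ∀ v ∈ Icc (0 : ℝ) 1,
      HasDerivWithinAt f₁ (-2 * e₁ v - (1 / 2) * f₁ v ^ 2) (Icc 0 1) v)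
    (hf₂ : ∀ v ∈ Icc (0 : ℝ) 1,
      HasDerivWithinAt f₂ (-2 * e₂ v - (1 / 2) * f₂ v ^ 2) (Icc 0 1) v)
    (hend : f₁ 1 = f₂ 1)
    (hb₁ : ∀ v ∈ Icc (0 : ℝ) 1, |f₁ v| ≤ A * δ)
    (hb₂ : ∀ v ∈ Icc (0 : ℝ) 1, |f₂ v| ≤ A * δ) :
    |f₁ 0 - f₂ 0| ≤ 2 * A ^ 2 * δ ^ 2 := by
  have h1 := abs_le.1 (stmt13_aux e₁ f₁ (A * δ) he₁ hf₁ hb₁)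
  have h2 := abs_le.1 (stmt13_aux e₂ f₂ (A * δ) he₂ hf₂ hb₂)
  have h3 : 0 ≤ A ^ 2 * δ ^ 2 := by positivity
  rw [mul_pow, hint] at h1
  rw [mul_pow] at h2
  rw [abs_le]
  constructor <;> linarith [h1.1, h1.2, h2.1, h2.2]
end

section
/- There exists an absolute constant C > 0 such that the following holds. Let f : ℝ³ → ℝ be three times continuously differentiable with f(x) = 0 for all x in the closed unit ball {‖x‖ ≤ 1}, and set K := sup_{‖y‖ ≤ 2} ‖D³f(y)‖, where D³f denotes the third iterated Fréchet derivative of f. Then for every ε ∈ (0, ½], ∫_{{x : 1 + ε ≤ ‖x‖ ≤ 1 + 2ε}} f(x)²/ε⁶ dx ≤ C · ε · K². -/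
open Metric MeasureTheory

theorem aux_taylor (f : EuclideanSpace ℝ (Fin 3) → ℝ) (hf : ContDiff ℝ 3 f)
    (h0 : ∀ x : EuclideanSpace ℝ (Fin 3), ‖x‖ ≤ 1 → f x = 0) (ε K : ℝ) (hε : 0 < ε)
    (hε2 : ε ≤ 1 / 2)
    (hK : ∀ y : EuclideanSpace ℝ (Fin 3), ‖y‖ ≤ 2 → ‖iteratedFDeriv ℝ 3 f y‖ ≤ K)
    (x : EuclideanSpace ℝ (Fin 3)) (hx1 : 1 + ε ≤ ‖x‖) (hx2 : ‖x‖ ≤ 1 + 2 * ε) :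
    |f x| ≤ 27 * ε ^ 3 * K := by
  have hxp : 0 < ‖x‖ := by linarith
  set u : EuclideanSpace ℝ (Fin 3) := ‖x‖⁻¹ • x with hu
  have hun : ‖u‖ = 1 := by
    rw [hu, norm_smul, norm_inv, norm_norm, inv_mul_cancel₀ hxp.ne']
  set L : ℝ →L[ℝ] EuclideanSpace ℝ (Fin 3) := ContinuousLinearMap.toSpanSingleton ℝ u with hL
  have hLn : ‖L‖ = 1 := by rw [hL, ContinuousLinearMap.norm_toSpanSingleton, hun]
  have hLa : ∀ t : ℝ, L t = t • u := fun t => by simp [hL]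
  have hLt : ∀ t : ℝ, ‖L t‖ = |t| := fun t => by rw [hLa, norm_smul, hun]; simp
  have hLx : L ‖x‖ = x := by
    rw [hLa, hu, smul_smul, mul_inv_cancel₀ hxp.ne', one_smul]
  have hg : ContDiff ℝ 3 (f ∘ L) := hf.comp L.contDiff
  have hlt : 1 - ε < ‖x‖ := by linarith
  obtain ⟨t, ht, hT⟩ := taylor_mean_remainder_lagrange_iteratedDeriv (f := f ∘ L) (n := 2)
    hlt.ne (by norm_num; exact hg.contDiffOn)
  rw [Set.uIoo_of_lt hlt] at ht
  have hev : (f ∘ L) =ᶠ[nhds (1 - ε)] (fun _ => (0 : ℝ)) := by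
    have : Set.Ioo (0 : ℝ) 1 ∈ nhds (1 - ε) := Ioo_mem_nhds (by linarith) (by linarith)
    filter_upwards [this] with s hs
    apply h0
    rw [hLt, abs_of_pos hs.1]
    exact hs.2.le
  have hz : taylorWithinEval (f ∘ L) 2 (Set.uIcc (1 - ε) ‖x‖) (1 - ε) ‖x‖ = 0 := by
    rw [taylor_within_apply]
    apply Finset.sum_eq_zero
    intro k _
    have : iteratedDerivWithin k (f ∘ L) (Set.uIcc (1 - ε) ‖x‖) (1 - ε) = 0 := by
      rw [iteratedDerivWithin_eq_iteratedFDerivWithin,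
        Filter.EventuallyEq.iteratedFDerivWithin_eq (hev.filter_mono nhdsWithin_le_nhds)
          hev.self_of_nhds]
      have := iteratedFDerivWithin_zero_fun (𝕜 := ℝ) (E := ℝ) (F := ℝ)
        (s := Set.uIcc (1 - ε) ‖x‖) (i := k)
      simp [this]
    rw [this, smul_zero]
  rw [hz, sub_zero, Function.comp_apply, hLx] at hT
  have htp : 0 < t := by linarith [ht.1]
  have hD : |iteratedDeriv 3 (f ∘ L) t| ≤ K := by
    rw [← Real.norm_eq_abs, ← norm_iteratedFDeriv_eq_norm_iteratedDeriv,
      L.iteratedFDeriv_comp_right hf t (i := 3) (by norm_num)]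
    refine (ContinuousMultilinearMap.norm_compContinuousLinearMap_le _ _).trans ?_
    simp only [hLn, Finset.prod_const_one, mul_one]
    apply hK
    rw [hLt, abs_of_pos htp]
    linarith [ht.2]
  have hd0 : 0 ≤ ‖x‖ - (1 - ε) := by linarith
  have hd : (‖x‖ - (1 - ε)) ^ 3 ≤ (3 * ε) ^ 3 := pow_le_pow_left₀ hd0 (by linarith) 3
  have hd0' : 0 ≤ (‖x‖ - (1 - ε)) ^ 3 := by positivity
  have hK0 : 0 ≤ K := (abs_nonneg _).trans hD
  rw [hT]
  norm_num [Nat.factorial]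
  rw [abs_div, abs_mul, abs_of_nonneg hd0', abs_of_pos (by norm_num : (0:ℝ) < 6)]
  have h1 := mul_le_mul hD hd hd0' hK0
  have h2 : 0 ≤ K * (3 * ε) ^ 3 := by positivity
  rw [div_le_iff₀ (by norm_num)]
  nlinarith

/-- Cutoff error estimate: there is an absolute constant `C > 0` such that for every `C³`
function `f : ℝ³ → ℝ` vanishing on the closed unit ball, with
`K = sup_{‖y‖ ≤ 2} ‖D³f(y)‖`, and every `ε ∈ (0, 1/2]`,
`∫_{1+ε ≤ ‖x‖ ≤ 1+2ε} f(x)²/ε⁶ dx ≤ C ε K²`. -/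
theorem stmt15 :
    ∃ C > (0 : ℝ),
      ∀ f : EuclideanSpace ℝ (Fin 3) → ℝ, ContDiff ℝ 3 f →
      (∀ x : EuclideanSpace ℝ (Fin 3), ‖x‖ ≤ 1 → f x = 0) →
      ∀ ε : ℝ, 0 < ε → ε ≤ 1 / 2 →
        (∫ x in {x : EuclideanSpace ℝ (Fin 3) | 1 + ε ≤ ‖x‖ ∧ ‖x‖ ≤ 1 + 2 * ε},
            f x ^ 2 / ε ^ 6) ≤
          C * ε * (⨆ y : closedBall (0 : EuclideanSpace ℝ (Fin 3)) 2,
            ‖iteratedFDeriv ℝ 3 f (y : EuclideanSpace ℝ (Fin 3))‖) ^ 2 := by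
  set m : ℝ := (volume : Measure (EuclideanSpace ℝ (Fin 3))).real (ball 0 1) with hm
  have hm0 : 0 ≤ m := measureReal_nonneg
  refine ⟨729 * 14 * m + 1, by positivity, ?_⟩
  intro f hf h0 ε hε hε2
  set K : ℝ := ⨆ y : closedBall (0 : EuclideanSpace ℝ (Fin 3)) 2,
            ‖iteratedFDeriv ℝ 3 f (y : EuclideanSpace ℝ (Fin 3))‖ with hKdef
  have hbdd : BddAbove (Set.range fun y : closedBall (0 : EuclideanSpace ℝ (Fin 3)) 2 =>
      ‖iteratedFDeriv ℝ 3 f (y : EuclideanSpace ℝ (Fin 3))‖) := by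
    have hc : Continuous fun y => ‖iteratedFDeriv ℝ 3 f y‖ :=
      (hf.continuous_iteratedFDeriv (m := 3) (by norm_num)).norm
    have := (isCompact_closedBall (0 : EuclideanSpace ℝ (Fin 3)) 2).bddAbove_image hc.continuousOn
    rwa [Set.image_eq_range] at this
  have hK : ∀ y : EuclideanSpace ℝ (Fin 3), ‖y‖ ≤ 2 → ‖iteratedFDeriv ℝ 3 f y‖ ≤ K :=
    fun y hy => le_ciSup hbdd (⟨y, by simpa using hy⟩ : closedBall _ _)
  set A := {x : EuclideanSpace ℝ (Fin 3) | 1 + ε ≤ ‖x‖ ∧ ‖x‖ ≤ 1 + 2 * ε} with hA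
  have hsub : A ⊆ closedBall 0 (1 + 2 * ε) \ closedBall 0 1 := by
    rintro x ⟨h1, h2⟩
    simp only [Set.mem_diff, mem_closedBall, dist_zero_right, not_le]
    exact ⟨h2, by linarith⟩
  have hAm : volume.real A ≤ 14 * ε * m := by
    have h1 : volume.real A ≤ volume.real
        (closedBall (0 : EuclideanSpace ℝ (Fin 3)) (1 + 2 * ε) \ closedBall 0 1) :=
      measureReal_mono hsub
        ((measure_mono Set.diff_subset).trans_lt measure_closedBall_lt_top).ne
    rw [measureReal_diff (closedBall_subset_closedBall (by linarith))
      measurableSet_closedBall measure_closedBall_lt_top.ne,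
      Measure.addHaar_real_closedBall _ _ (by linarith), Measure.addHaar_real_closedBall _ _ zero_le_one,
      ← hm, finrank_euclideanSpace_fin] at h1
    refine h1.trans ?_
    rw [← sub_mul]
    refine mul_le_mul_of_nonneg_right ?_ hm0
    nlinarith [mul_pos hε hε, mul_nonneg hε.le (sub_nonneg.2 hε2), mul_nonneg (mul_pos hε hε).le (sub_nonneg.2 hε2)]
  have hfin : volume A < ⊤ :=
    (measure_mono (hsub.trans Set.diff_subset)).trans_lt measure_closedBall_lt_top
  have hbound : ∀ x ∈ A, ‖f x ^ 2 / ε ^ 6‖ ≤ 729 * K ^ 2 := by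
    rintro x ⟨h1, h2⟩
    have h := aux_taylor f hf h0 ε K hε hε2 hK x h1 h2
    have h3 : |f x| ^ 2 ≤ (27 * ε ^ 3 * K) ^ 2 := pow_le_pow_left₀ (abs_nonneg _) h 2
    rw [sq_abs] at h3
    rw [Real.norm_of_nonneg (by positivity), div_le_iff₀ (by positivity)]
    linarith
  have hI := norm_setIntegral_le_of_norm_le_const hfin hbound
  refine (Real.le_norm_self _).trans (hI.trans ?_)
  have h5 : 729 * K ^ 2 * volume.real A ≤ 729 * K ^ 2 * (14 * ε * m) :=
    mul_le_mul_of_nonneg_left hAm (by positivity)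
  have h6 : 0 ≤ ε * K ^ 2 := by positivity
  linarith
end
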